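/- arXiv:1807.03423 — 2 statements merged into one kernel-verified Lean document; each statement's English description precedes it below -/
import Mathlib

section
/- Let G = N ⋊ ℤ be a finitely generated group with N abelian, where a fixed generator x of ℤ acts on N by conjugation, making N a module over the Laurent polynomial ring ℤ[x, x⁻¹]. Then for every n, m_n(G) = m_n(ℤ) + n·m_n(N), where m_n(ℤ) equals 1 if n is prime and 0 otherwise, and m_n(N) is the number of maximal ℤ[x,x⁻¹]-submodules of N of index n (equivalently, subgroups of N of index n that are normal in G and maximal among proper subgroups of N normal in G). -/
/-- The number of maximal subgroups of `G` of index `n`. -/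
noncomputable def maxSubgroupCount (G : Type*) [Group G] (n : ℕ) : ℕ :=
  Nat.card {H : Subgroup G // IsCoatom H ∧ H.index = n}

/-- The semidirect product `N ⋊ ℤ` in which a fixed generator of `ℤ` acts on the
abelian group `N` via the automorphism `θ`. -/
abbrev abelianByZ (N : Type*) [AddCommGroup N] (θ : N ≃+ N) : Type _ :=
  SemidirectProduct (Multiplicative N) (Multiplicative ℤ)
    (zpowersHom (MulAut (Multiplicative N)) (AddEquiv.toMultiplicative θ))

/-- A `ℤ[x,x⁻¹]`-submodule of `N`, where `x` acts via `θ`: a subgroup invariant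
under `θ` and `θ⁻¹`. -/
def IsLaurentSubmodule {N : Type*} [AddCommGroup N] (θ : N ≃+ N) (S : AddSubgroup N) :
    Prop :=
  (∀ a ∈ S, θ a ∈ S) ∧ (∀ a ∈ S, θ.symm a ∈ S)

namespace Subgroup

variable {G : Type*} [Group G]

theorem isCoatom_of_prime_index {H : Subgroup G} (h : H.index.Prime) : IsCoatom H := by
  refine ⟨fun hH ↦ h.ne_one (index_eq_one.2 hH), fun L hL ↦ ?_⟩
  have hmul := relIndex_mul_index hL.le
  rcases (Nat.dvd_prime h).1 (Dvd.intro_left _ hmul) with h1 | h1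
  · exact index_eq_one.1 h1
  · rw [h1] at hmul
    exact absurd (relIndex_eq_one.1 ((mul_eq_right₀ h.ne_zero).1 hmul)) hL.not_ge

end Subgroup

theorem Group.FG.finite_monoidHom {G P : Type*} [Group G] [Group P] [Finite P]
    (hG : Group.FG G) : Finite (G →* P) := by
  obtain ⟨S, hS, hfin⟩ := Group.fg_iff.1 hG
  have := hfin.to_subtype
  refine Finite.of_injective (fun (φ : G →* P) (s : S) ↦ φ s) fun φ ψ h ↦ ?_
  exact MonoidHom.eq_of_eqOn_dense hS fun s hs ↦ congrFun h ⟨s, hs⟩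

theorem Group.FG.finite_setOf_index_eq {G : Type*} [Group G] (hG : Group.FG G) {n : ℕ}
    (hn : n ≠ 0) : {H : Subgroup G | H.index = n}.Finite := by
  have := hG.finite_monoidHom (P := Equiv.Perm (Fin n))
  refine (Set.finite_range fun p : (G →* Equiv.Perm (Fin n)) × Fin n ↦
    (MulAction.stabilizer (Equiv.Perm (Fin n)) p.2).comap p.1).subset fun H hH ↦ ?_
  have hcard : Nat.card (G ⧸ H) = n := hH
  have : Finite (G ⧸ H) := Nat.finite_of_card_ne_zero (hcard ▸ hn)
  let e : G ⧸ H ≃ Fin n := Finite.equivFinOfCardEq hcard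
  refine ⟨(e.permCongrHom.toMonoidHom.comp (MulAction.toPermHom G (G ⧸ H)),
    e ((1 : G) : G ⧸ H)), ?_⟩
  conv_rhs => rw [← MulAction.stabilizer_quotient H]
  ext g
  simp [MulAction.mem_stabilizer_iff, Equiv.permCongrHom, -MulAction.stabilizer_quotient]

/-- The subgroup `nℤ` of the infinite cyclic group, written multiplicatively. -/
def multiplesSubgroup (n : ℕ) : Subgroup (Multiplicative ℤ) :=
  AddSubgroup.toSubgroup (AddSubgroup.zmultiples (n : ℤ))

theorem index_multiplesSubgroup (n : ℕ) : (multiplesSubgroup n).index = n :=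
  (Int.index_zmultiples n).trans (Int.natAbs_natCast n)

theorem multiplesSubgroup_le_of_dvd {d n : ℕ} (h : d ∣ n) :
    multiplesSubgroup n ≤ multiplesSubgroup d := by
  refine AddSubgroup.toSubgroup.monotone ?_
  rw [AddSubgroup.zmultiples_le, Int.mem_zmultiples_iff]
  exact_mod_cast h

theorem eq_multiplesSubgroup_index (K : Subgroup (Multiplicative ℤ)) :
    K = multiplesSubgroup K.index := by
  obtain ⟨a, ha⟩ := Int.subgroup_cyclic (AddSubgroup.toSubgroup.symm K)
  have hK : K = AddSubgroup.toSubgroup (AddSubgroup.zmultiples a) := by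
    rw [AddSubgroup.zmultiples_eq_closure, ← ha, OrderIso.apply_symm_apply]
  have hi : K.index = a.natAbs := by
    rw [hK]; exact Int.index_zmultiples a
  rw [hi, multiplesSubgroup, Int.zmultiples_natAbs, ← hK]

namespace ExtensionByInt

variable {G : Type*} [Group G] {f : G →* Multiplicative ℤ}

theorem eq_comap_multiplesSubgroup (hf : Function.Surjective f) {H : Subgroup G}
    (hH : f.ker ≤ H) : H = (multiplesSubgroup H.index).comap f := by
  have h1 : (H.map f).comap f = H := Subgroup.comap_map_eq_self hH
  have h2 : H.index = (H.map f).index := by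
    rw [← Subgroup.index_comap_of_surjective _ hf, h1]
  rw [h2, ← eq_multiplesSubgroup_index, h1]

theorem index_comap_multiplesSubgroup (hf : Function.Surjective f) (n : ℕ) :
    ((multiplesSubgroup n).comap f).index = n := by
  rw [Subgroup.index_comap_of_surjective _ hf, index_multiplesSubgroup]

theorem prime_index_of_ker_le (hf : Function.Surjective f) {H : Subgroup G} (hH : IsCoatom H)
    (hker : f.ker ≤ H) : H.index.Prime := by
  have hdvd {d : ℕ} (hd : d ∣ H.index) : d = 1 ∨ d = H.index := by
    have hle : H ≤ (multiplesSubgroup d).comap f :=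
      (eq_comap_multiplesSubgroup hf hker).trans_le
        (Subgroup.comap_mono (multiplesSubgroup_le_of_dvd hd))
    rcases hH.le_iff.1 hle with h | h
    · exact .inl (by rw [← index_comap_multiplesSubgroup hf d, h, Subgroup.index_top])
    · exact .inr (by rw [← index_comap_multiplesSubgroup hf d, h])
  refine Nat.prime_def.2 ⟨(Nat.two_le_iff _).2 ⟨fun h0 ↦ ?_, fun h1 ↦ ?_⟩, fun d hd ↦ hdvd hd⟩
  · rw [h0] at hdvd
    simpa using hdvd (dvd_zero 2)
  · exact hH.1 (Subgroup.index_eq_one.1 h1)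

theorem setOf_isCoatom_ker_le_eq_empty (hf : Function.Surjective f) {n : ℕ} (hn : ¬ n.Prime) :
    {H : Subgroup G | IsCoatom H ∧ H.index = n ∧ f.ker ≤ H} = ∅ :=
  Set.eq_empty_of_forall_notMem fun _ h ↦ hn (h.2.1 ▸ prime_index_of_ker_le hf h.1 h.2.2)

theorem ncard_isCoatom_ker_le (hf : Function.Surjective f) (n : ℕ) :
    {H : Subgroup G | IsCoatom H ∧ H.index = n ∧ f.ker ≤ H}.ncard =
      if n.Prime then 1 else 0 := by
  split_ifs with hn
  · rw [Set.ncard_eq_one]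
    refine ⟨(multiplesSubgroup n).comap f, ?_⟩
    ext H
    simp only [Set.mem_ofPred_eq, Set.mem_singleton_iff]
    constructor
    · rintro ⟨-, rfl, hker⟩
      exact eq_comap_multiplesSubgroup hf hker
    · rintro rfl
      have hidx := index_comap_multiplesSubgroup hf n
      exact ⟨Subgroup.isCoatom_of_prime_index (by rwa [hidx]), hidx, f.ker_le_comap _⟩
  · rw [setOf_isCoatom_ker_le_eq_empty hf hn, Set.ncard_empty]

/-- The maximal proper subgroups of `f.ker` of index `n` among those normal in `G`. -/
def maxNormalInKer (f : G →* Multiplicative ℤ) (n : ℕ) : Set (Subgroup G) :=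
  {S | S.Normal ∧ S.relIndex f.ker = n ∧ S < f.ker ∧
    ∀ T : Subgroup G, T.Normal → T ≤ f.ker → S < T → T = f.ker}

theorem normal_inf_ker (hcomm : ∀ a ∈ f.ker, ∀ b ∈ f.ker, a * b = b * a) {H : Subgroup G}
    (hH : H ⊔ f.ker = ⊤) : (H ⊓ f.ker).Normal := by
  refine ⟨fun s hs g ↦ ?_⟩
  obtain ⟨h, hh, k, hk, rfl⟩ := Subgroup.mem_sup_of_normal_right.1 (hH ▸ Subgroup.mem_top g)
  have : h * k * s * (h * k)⁻¹ = h * s * h⁻¹ := by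
    rw [mul_assoc h k s, hcomm k hk s hs.2]; group
  rw [this]
  exact ⟨H.mul_mem (H.mul_mem hh hs.1) (H.inv_mem hh),
    (inferInstance : f.ker.Normal).conj_mem s hs.2 h⟩

theorem index_eq_relIndex_inf_ker {H : Subgroup G} (hH : H ⊔ f.ker = ⊤) :
    H.index = (H ⊓ f.ker).relIndex f.ker := by
  rw [Subgroup.inf_relIndex_right]
  have hrel (a b : f.ker) :
      QuotientGroup.leftRel (H.subgroupOf f.ker) a b ↔ QuotientGroup.leftRel H (a : G) b := by
    rw [QuotientGroup.leftRel_apply, QuotientGroup.leftRel_apply]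
    rfl
  refine (Nat.card_congr (Equiv.ofBijective (Quotient.map' (s₁ := QuotientGroup.leftRel
    (H.subgroupOf f.ker)) (s₂ := QuotientGroup.leftRel H) Subtype.val fun a b ↦ (hrel a b).1)
    ⟨?_, ?_⟩)).symm
  · rintro ⟨a⟩ ⟨b⟩ h
    exact Quotient.sound ((hrel a b).2 (Quotient.exact h))
  · rintro ⟨g⟩
    obtain ⟨k, hk, h, hh, rfl⟩ := Subgroup.mem_sup_of_normal_left.1
      ((sup_comm H f.ker ▸ hH) ▸ Subgroup.mem_top g)
    refine ⟨Quotient.mk _ ⟨k, hk⟩, Quotient.sound ?_⟩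
    exact QuotientGroup.leftRel_apply.2 (by simpa using hh)

theorem isCoatom_iff_of_sup_ker_eq_top (hcomm : ∀ a ∈ f.ker, ∀ b ∈ f.ker, a * b = b * a)
    {H : Subgroup G} (hH : H ⊔ f.ker = ⊤) {n : ℕ} :
    (IsCoatom H ∧ H.index = n) ↔ H ⊓ f.ker ∈ maxNormalInKer f n := by
  rw [index_eq_relIndex_inf_ker hH]
  constructor
  · rintro ⟨hc, hi⟩
    refine ⟨normal_inf_ker hcomm hH, hi, inf_le_right.lt_of_ne fun h ↦ ?_,
      fun T hT hTle hlt ↦ hTle.antisymm fun k hk ↦ ?_⟩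
    · exact hc.1 (by rw [← hH, left_eq_sup]; exact inf_eq_right.1 h)
    · have htop : H ⊔ T = ⊤ := hc.2 _ <| left_lt_sup.2 fun hle ↦ hlt.not_ge (le_inf hle hTle)
      obtain ⟨h, hh, t, ht, rfl⟩ := Subgroup.mem_sup_of_normal_right.1
        (htop ▸ Subgroup.mem_top k)
      refine T.mul_mem (hlt.le ⟨hh, ?_⟩) ht
      exact (Subgroup.mul_mem_cancel_right _ (hTle ht)).1 hk
  · rintro ⟨-, hi, hlt, hmax⟩
    refine ⟨⟨?_, fun K hK ↦ ?_⟩, hi⟩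
    · rintro rfl
      simp at hlt
    · have hK' : K ⊔ f.ker = ⊤ := top_le_iff.1 (hH ▸ sup_le_sup_right hK.le _)
      by_cases hker : f.ker ≤ K
      · rwa [sup_eq_left.2 hker] at hK'
      have heq : H ⊓ f.ker = K ⊓ f.ker := by
        by_contra hne
        exact hker <| inf_eq_right.1 <| hmax _ (normal_inf_ker hcomm hK') inf_le_right
          ((inf_le_inf_right _ hK.le).lt_of_ne hne)
      refine absurd (fun k hk ↦ ?_) hK.not_ge
      obtain ⟨h, hh, t, ht, rfl⟩ := Subgroup.mem_sup_of_normal_right.1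
        (hH ▸ Subgroup.mem_top k)
      have ht' : t ∈ K ⊓ f.ker := ⟨(K.mul_mem_cancel_left (hK.le hh)).1 hk, ht⟩
      rw [← heq] at ht'
      exact H.mul_mem hh ht'.1

variable {x : G} {S : Subgroup G}

theorem sup_zpowers_inf_ker (hS : S.Normal) (hle : S ≤ f.ker) {y : G}
    (hy : f y = Multiplicative.ofAdd 1) : (S ⊔ Subgroup.zpowers y) ⊓ f.ker = S := by
  refine le_antisymm ?_ (le_inf le_sup_left hle)
  rintro g ⟨hg, hgk⟩
  obtain ⟨s, hs, z, hz, rfl⟩ := Subgroup.mem_sup_of_normal_left.1 hg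
  obtain ⟨k, rfl⟩ := Subgroup.mem_zpowers_iff.1 hz
  have hk : f (y ^ k) = 1 := (Subgroup.mul_mem_cancel_left _ (hle hs)).1 hgk
  rw [map_zpow, hy, ← ofAdd_zsmul, ofAdd_eq_one] at hk
  have hk0 : k = 0 := by simpa using hk
  simpa [hk0] using hs

theorem mul_zpow_neg_mem_ker {y : G} (hy : f y = Multiplicative.ofAdd 1) (g : G) :
    g * y ^ (-(f g).toAdd) ∈ f.ker := by
  rw [MonoidHom.mem_ker, map_mul, map_zpow, hy, ← ofAdd_zsmul]
  apply Multiplicative.toAdd.injective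
  simp

theorem sup_zpowers_eq {H : Subgroup G} {y : G} (hy : f y = Multiplicative.ofAdd 1)
    (hyH : y ∈ H) : (H ⊓ f.ker) ⊔ Subgroup.zpowers y = H := by
  refine le_antisymm (sup_le inf_le_left ((Subgroup.zpowers_le).2 hyH)) fun g hg ↦ ?_
  have h1 : g * y ^ (-(f g).toAdd) ∈ H ⊓ f.ker :=
    ⟨H.mul_mem hg (H.zpow_mem hyH _), mul_zpow_neg_mem_ker hy g⟩
  have h2 := Subgroup.mul_mem_sup h1 (Subgroup.zpow_mem_zpowers y (f g).toAdd)
  simpa [mul_assoc] using h2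

theorem sup_ker_eq_top {H : Subgroup G} {y : G} (hy : f y = Multiplicative.ofAdd 1)
    (hyH : y ∈ H) : H ⊔ f.ker = ⊤ := by
  refine top_le_iff.1 fun g _ ↦ ?_
  have h2 := mul_mem (Subgroup.mem_sup_right (S := H) (mul_zpow_neg_mem_ker hy g))
    (Subgroup.mem_sup_left (T := f.ker) (H.zpow_mem hyH (f g).toAdd))
  simpa [mul_assoc] using h2

/-- The subgroups supplementing `f.ker` and meeting it in `S` correspond to the cosets of `S`
in `f.ker`. -/
theorem card_supplement (hx : f x = Multiplicative.ofAdd 1) (hS : S.Normal) (hle : S ≤ f.ker) :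
    Nat.card {H : Subgroup G // H ⊔ f.ker = ⊤ ∧ H ⊓ f.ker = S} = S.relIndex f.ker := by
  have hfx (a : f.ker) : f (x * a) = Multiplicative.ofAdd 1 := by
    rw [map_mul, hx, f.mem_ker.1 a.2, mul_one]
  have hmem (a : f.ker) : x * (a : G) ∈ S ⊔ Subgroup.zpowers (x * (a : G)) :=
    Subgroup.mem_sup_right (Subgroup.mem_zpowers _)
  let φ (a : f.ker) : {H : Subgroup G // H ⊔ f.ker = ⊤ ∧ H ⊓ f.ker = S} :=
    ⟨S ⊔ Subgroup.zpowers (x * a), sup_ker_eq_top (hfx a) (hmem a),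
      sup_zpowers_inf_ker hS hle (hfx a)⟩
  have hφ (a b : f.ker) : φ a = φ b ↔ (a : G)⁻¹ * b ∈ S := by
    constructor
    · intro h
      have hb : x * (b : G) ∈ (φ a).1 := h ▸ hmem b
      rw [← (φ a).2.2]
      refine ⟨?_, Subgroup.mul_mem _ (Subgroup.inv_mem _ a.2) b.2⟩
      simpa [mul_assoc] using Subgroup.mul_mem _ (Subgroup.inv_mem _ (hmem a)) hb
    · intro h
      have hb : x * (b : G) ∈ (φ a).1 := by
        simpa [mul_assoc] using Subgroup.mul_mem _ (hmem a)
          (Subgroup.mem_sup_left (T := Subgroup.zpowers (x * (a : G))) h)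
      have := sup_zpowers_eq (hfx b) hb
      rw [(φ a).2.2] at this
      exact Subtype.ext this.symm
  have hsurj : Function.Surjective φ := by
    rintro ⟨H, hH, rfl⟩
    obtain ⟨h, hh, k, hk, hhk⟩ := Subgroup.mem_sup_of_normal_right.1 (hH ▸ Subgroup.mem_top x)
    have hxk : x * k⁻¹ ∈ H := by rw [← hhk]; simpa using hh
    exact ⟨⟨k⁻¹, inv_mem hk⟩, Subtype.ext (sup_zpowers_eq (hfx ⟨k⁻¹, inv_mem hk⟩) hxk)⟩
  refine (Nat.card_congr (Equiv.ofBijective (Quotient.lift (s := QuotientGroup.leftRel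
    (S.subgroupOf f.ker)) φ fun a b h ↦ (hφ a b).2 ?_) ⟨?_, ?_⟩)).symm
  · exact QuotientGroup.leftRel_apply (s := S.subgroupOf f.ker).1 h
  · rintro ⟨a⟩ ⟨b⟩ h
    exact Quotient.sound (QuotientGroup.leftRel_apply.2 ((hφ a b).1 h))
  · intro H
    obtain ⟨a, rfl⟩ := hsurj H
    exact ⟨Quotient.mk _ a, rfl⟩

theorem ncard_isCoatom_not_ker_le (hcomm : ∀ a ∈ f.ker, ∀ b ∈ f.ker, a * b = b * a)
    (hx : f x = Multiplicative.ofAdd 1) (n : ℕ) :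
    {H : Subgroup G | IsCoatom H ∧ H.index = n ∧ ¬ f.ker ≤ H}.ncard =
      n * (maxNormalInKer f n).ncard := by
  have hset : {H : Subgroup G | IsCoatom H ∧ H.index = n ∧ ¬ f.ker ≤ H} =
      {H | H ⊔ f.ker = ⊤ ∧ H ⊓ f.ker ∈ maxNormalInKer f n} := by
    ext H
    constructor
    · rintro ⟨hc, hi, hker⟩
      have hH : H ⊔ f.ker = ⊤ := hc.2 _ (left_lt_sup.2 hker)
      exact ⟨hH, (isCoatom_iff_of_sup_ker_eq_top hcomm hH).1 ⟨hc, hi⟩⟩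
    · rintro ⟨hH, hS⟩
      have h := (isCoatom_iff_of_sup_ker_eq_top hcomm hH).2 hS
      exact ⟨h.1, h.2, fun hle ↦ hS.2.2.1.ne (inf_eq_right.2 hle)⟩
  rw [hset]
  let X := {H : Subgroup G | H ⊔ f.ker = ⊤ ∧ H ⊓ f.ker ∈ maxNormalInKer f n}
  let r (H : X) : maxNormalInKer f n := ⟨H.1 ⊓ f.ker, H.2.2⟩
  let e (S : maxNormalInKer f n) : {H : X // r H = S} ≃
      {H : Subgroup G // H ⊔ f.ker = ⊤ ∧ H ⊓ f.ker = S} :=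
    { toFun H := ⟨H.1.1, H.1.2.1, congrArg Subtype.val H.2⟩
      invFun H := ⟨⟨H.1, H.2.1, by rw [H.2.2]; exact S.2⟩, Subtype.ext H.2.2⟩
      left_inv _ := rfl
      right_inv _ := rfl }
  have hcard (S : maxNormalInKer f n) : Nat.card {H : X // r H = S} = n := by
    rw [Nat.card_congr (e S), card_supplement hx S.2.1 S.2.2.2.1.le, S.2.2.1]
  change Nat.card X = n * Nat.card (maxNormalInKer f n)
  rcases eq_or_ne n 0 with rfl | hn
  · rw [zero_mul]
    by_contra h0
    obtain ⟨⟨H⟩, hfin⟩ := Nat.card_ne_zero.1 h0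
    have : Nonempty {H' : X // r H' = r H} := ⟨⟨H, rfl⟩⟩
    exact Nat.card_pos.ne' (hcard (r H))
  · have e' (S : maxNormalInKer f n) : {H : X // r H = S} ≃ Fin n :=
      have := Nat.finite_of_card_ne_zero ((hcard S).trans_ne hn)
      Finite.equivFinOfCardEq (hcard S)
    rw [Nat.card_congr ((Equiv.sigmaFiberEquiv r).symm.trans (Equiv.sigmaEquivProdOfEquiv e')),
      Nat.card_prod, Nat.card_fin, mul_comm]

theorem maxSubgroupCount_eq (hG : Group.FG G)
    (hcomm : ∀ a ∈ f.ker, ∀ b ∈ f.ker, a * b = b * a)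
    (hx : f x = Multiplicative.ofAdd 1) (n : ℕ) :
    maxSubgroupCount G n =
      (if n.Prime then 1 else 0) + n * (maxNormalInKer f n).ncard := by
  have hf : Function.Surjective f := fun z ↦
    ⟨x ^ z.toAdd, by rw [map_zpow, hx, ← ofAdd_zsmul]; simp⟩
  rw [← ncard_isCoatom_ker_le hf, ← ncard_isCoatom_not_ker_le hcomm hx]
  have hunion : {H : Subgroup G | IsCoatom H ∧ H.index = n} =
      {H | IsCoatom H ∧ H.index = n ∧ f.ker ≤ H} ∪
        {H | IsCoatom H ∧ H.index = n ∧ ¬ f.ker ≤ H} := by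
    ext H
    simp only [Set.mem_ofPred_eq, Set.mem_union]
    tauto
  change {H : Subgroup G | IsCoatom H ∧ H.index = n}.ncard = _
  rcases eq_or_ne n 0 with rfl | hn
  · rw [hunion, setOf_isCoatom_ker_le_eq_empty hf Nat.not_prime_zero, Set.empty_union,
      Set.ncard_empty, zero_add]
  · have hfin := hG.finite_setOf_index_eq hn
    rw [hunion]
    exact Set.ncard_union_eq (Set.disjoint_left.2 fun H h h' ↦ h'.2.2 h.2.2)
      (hfin.subset fun H h ↦ h.2.1) (hfin.subset fun H h ↦ h.2.1)

end ExtensionByInt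

namespace abelianByZ

open SemidirectProduct ExtensionByInt

variable {N : Type*} [AddCommGroup N] (θ : N ≃+ N)

/-- The projection of `N ⋊ ℤ` onto `ℤ`. -/
abbrev proj : abelianByZ N θ →* Multiplicative ℤ := rightHom

/-- A subgroup of `N`, viewed as a subgroup of `N ⋊ ℤ`. -/
def embed (S : AddSubgroup N) : Subgroup (abelianByZ N θ) :=
  (AddSubgroup.toSubgroup S).map inl

variable {θ}

theorem inl_mem_embed {S : AddSubgroup N} {a : N} :
    inl (Multiplicative.ofAdd a) ∈ embed θ S ↔ a ∈ S :=
  Subgroup.mem_map_iff_mem inl_injective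

theorem embed_le_embed {S T : AddSubgroup N} : embed θ S ≤ embed θ T ↔ S ≤ T :=
  (Subgroup.map_le_map_iff_of_injective inl_injective).trans
    AddSubgroup.toSubgroup.le_iff_le

theorem embed_injective : Function.Injective (embed θ) := fun _ _ h ↦
  le_antisymm (embed_le_embed.1 h.le) (embed_le_embed.1 h.ge)

theorem embed_lt_embed {S T : AddSubgroup N} : embed θ S < embed θ T ↔ S < T := by
  simp only [lt_iff_le_not_ge, embed_le_embed]

theorem embed_top : embed θ ⊤ = (proj θ).ker := by
  rw [← range_inl_eq_ker_rightHom, MonoidHom.range_eq_map]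
  rfl

theorem exists_embed_eq {T : Subgroup (abelianByZ N θ)} (hT : T ≤ (proj θ).ker) :
    ∃ S, embed θ S = T := by
  refine ⟨AddSubgroup.toSubgroup.symm (T.comap inl), ?_⟩
  rw [embed, OrderIso.apply_symm_apply]
  exact Subgroup.map_comap_eq_self (by rwa [range_inl_eq_ker_rightHom])

theorem relIndex_embed (S : AddSubgroup N) : (embed θ S).relIndex (proj θ).ker = S.index := by
  rw [← embed_top, embed, embed, Subgroup.relIndex_map_map_of_injective _ _ inl_injective]
  exact Subgroup.relIndex_top_right _

theorem conj_inl (k : Multiplicative ℤ) (a : N) :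
    (inr k * inl (Multiplicative.ofAdd a) * (inr k)⁻¹ : abelianByZ N θ) =
      inl (zpowersHom (MulAut (Multiplicative N)) (AddEquiv.toMultiplicative θ) k
        (Multiplicative.ofAdd a)) := by
  rw [inl_aut, map_inv]

theorem normal_embed_iff {S : AddSubgroup N} : (embed θ S).Normal ↔ IsLaurentSubmodule θ S := by
  constructor
  · intro h
    constructor
    · intro a ha
      have := h.conj_mem _ (inl_mem_embed.2 ha) (inr (Multiplicative.ofAdd 1))
      rw [conj_inl, zpowersHom_apply, toAdd_ofAdd, zpow_one] at this
      exact inl_mem_embed.1 this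
    · intro a ha
      have := h.conj_mem _ (inl_mem_embed.2 ha) (inr (Multiplicative.ofAdd (-1)))
      rw [conj_inl, zpowersHom_apply, toAdd_ofAdd, zpow_neg_one] at this
      exact inl_mem_embed.1 this
  · intro h
    have key (k : ℤ) : ∀ a ∈ S, ((AddEquiv.toMultiplicative θ : MulAut (Multiplicative N)) ^ k)
        (Multiplicative.ofAdd a) ∈ AddSubgroup.toSubgroup S := by
      induction k with
      | zero => intro a ha; simpa using ha
      | succ k ih =>
        intro a ha
        rw [zpow_add_one]
        exact ih _ (h.1 a ha)
      | pred k ih =>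
        intro a ha
        rw [zpow_sub_one]
        exact ih _ (h.2 a ha)
    constructor
    rintro _ ⟨a, ha, rfl⟩ g
    have hg : g * inl a * g⁻¹ = inr g.right * inl a * (inr g.right)⁻¹ := by
      rw [← map_inv, ← inl_aut]
      conv_lhs => rw [← inl_left_mul_inr_right g]
      rw [mul_inv_rev, mul_assoc _ (inr _), ← mul_assoc, mul_assoc (inl _), ← map_inv inr,
        ← inl_aut, ← map_mul, ← map_inv, ← map_mul, mul_inv_cancel_comm]
    rw [hg]
    have := conj_inl (θ := θ) g.right a.toAdd
    rw [ofAdd_toAdd] at this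
    rw [this]
    exact ⟨_, key _ _ ha, rfl⟩

theorem ncard_maxNormalInKer_proj (n : ℕ) :
    (maxNormalInKer (proj θ) n).ncard =
      Nat.card {S : AddSubgroup N // IsLaurentSubmodule θ S ∧ S.index = n ∧
        S ≠ ⊤ ∧ ∀ T : AddSubgroup N, IsLaurentSubmodule θ T → S < T → T = ⊤} := by
  have h : maxNormalInKer (proj θ) n = embed θ '' {S | IsLaurentSubmodule θ S ∧ S.index = n ∧
      S ≠ ⊤ ∧ ∀ T : AddSubgroup N, IsLaurentSubmodule θ T → S < T → T = ⊤} := by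
    have hiff (S : AddSubgroup N) : embed θ S ∈ maxNormalInKer (proj θ) n ↔
        IsLaurentSubmodule θ S ∧ S.index = n ∧
          S ≠ ⊤ ∧ ∀ T : AddSubgroup N, IsLaurentSubmodule θ T → S < T → T = ⊤ := by
      rw [maxNormalInKer, Set.mem_ofPred_eq, normal_embed_iff, relIndex_embed, ← embed_top,
        embed_lt_embed, lt_top_iff_ne_top]
      refine and_congr_right' (and_congr_right' (and_congr_right' ⟨fun h T hT hlt ↦ ?_,
        fun h T hT hle hlt ↦ ?_⟩))
      · exact embed_injective (h _ (normal_embed_iff.2 hT) (embed_le_embed.2 le_top)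
          (embed_lt_embed.2 hlt))
      · obtain ⟨T, rfl⟩ := exists_embed_eq (hle.trans_eq embed_top)
        rw [h T (normal_embed_iff.1 hT) (embed_lt_embed.1 hlt)]
    ext T
    constructor
    · intro hT
      obtain ⟨S, rfl⟩ := exists_embed_eq hT.2.2.1.le
      exact ⟨S, (hiff S).1 hT, rfl⟩
    · rintro ⟨S, hS, rfl⟩
      exact (hiff S).2 hS
  rw [h, Set.ncard_image_of_injective _ embed_injective]
  rfl

theorem commute_of_mem_ker_proj (a : abelianByZ N θ) (ha : a ∈ (proj θ).ker)
    (b : abelianByZ N θ) (hb : b ∈ (proj θ).ker) : a * b = b * a := by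
  rw [← range_inl_eq_ker_rightHom] at ha hb
  obtain ⟨a, rfl⟩ := ha
  obtain ⟨b, rfl⟩ := hb
  rw [← map_mul, ← map_mul, mul_comm]

end abelianByZ

theorem stmt18 {N : Type*} [AddCommGroup N] (θ : N ≃+ N)
    (hfg : Group.FG (abelianByZ N θ)) (n : ℕ) :
    maxSubgroupCount (abelianByZ N θ) n =
      (if n.Prime then 1 else 0) +
        n * Nat.card {S : AddSubgroup N // IsLaurentSubmodule θ S ∧ S.index = n ∧
          S ≠ ⊤ ∧ ∀ T : AddSubgroup N, IsLaurentSubmodule θ T → S < T → T = ⊤} := by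
  rw [← abelianByZ.ncard_maxNormalInKer_proj]
  exact ExtensionByInt.maxSubgroupCount_eq (f := abelianByZ.proj θ)
    (x := SemidirectProduct.inr (Multiplicative.ofAdd 1)) hfg
    abelianByZ.commute_of_mem_ker_proj (SemidirectProduct.rightHom_inr _) n
end

section
/- Let σ be a permutation of {1, …, k} with exactly c cycles (fixed points counted as cycles), and let G = ℤ^k ⋊_σ ℤ be the semidirect product in which a fixed generator of ℤ acts on ℤ^k by permuting the coordinates according to σ. Then mdeg(G) = c. -/
/-- `mdeg G`, the degree of maximal subgroup growth of `G`:
`limsup (log m_n(G) / log n)`. -/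
noncomputable def mdeg (G : Type*) [Group G] : ℝ :=
  Filter.atTop.limsup fun n : ℕ => Real.log (maxSubgroupCount G n) / Real.log n

/-- The automorphism of `ℤ^k` permuting the coordinates according to `σ`. -/
def permAddEquiv {k : ℕ} (σ : Equiv.Perm (Fin k)) : (Fin k → ℤ) ≃+ (Fin k → ℤ) :=
  ⟨Equiv.piCongrLeft' (fun _ => ℤ) σ, fun _ _ => rfl⟩

/-- The semidirect product `ℤ^k ⋊_σ ℤ` in which a fixed generator of `ℤ` acts on `ℤ^k`
by permuting the coordinates according to `σ`. -/
abbrev zkByPermZ (k : ℕ) (σ : Equiv.Perm (Fin k)) : Type :=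
  SemidirectProduct (Multiplicative (Fin k → ℤ)) (Multiplicative ℤ)
    (zpowersHom (MulAut (Multiplicative (Fin k → ℤ)))
      (AddEquiv.toMultiplicative (permAddEquiv σ)))

namespace zkByPermZ

variable {k : ℕ} {σ : Equiv.Perm (Fin k)}

theorem permAddEquiv_apply (v : Fin k → ℤ) (i : Fin k) :
    permAddEquiv σ v i = v (σ.symm i) := rfl

theorem permAddEquiv_single (i : Fin k) (a : ℤ) :
    permAddEquiv σ (Pi.single i a) = Pi.single (σ i) a := by
  ext j
  simp only [permAddEquiv_apply, Pi.single_apply, Equiv.symm_apply_eq]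

theorem permAddEquiv_iterate (n : ℕ) (v : Fin k → ℤ) (i : Fin k) :
    (permAddEquiv σ)^[n] v i = v ((σ ^ n)⁻¹ i) := by
  induction n generalizing i with
  | zero => rfl
  | succ n ih =>
    rw [Function.iterate_succ_apply', permAddEquiv_apply, ih, pow_succ', mul_inv_rev]
    rfl

theorem permAddEquiv_iterate_orderOf (v : Fin k → ℤ) :
    (permAddEquiv σ)^[orderOf σ] v = v := by
  ext i
  simp [permAddEquiv_iterate, pow_orderOf_eq_one]

/-- The embedding of `ℤ^k` into `ℤ^k ⋊_σ ℤ`. -/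
def emb (σ : Equiv.Perm (Fin k)) : Multiplicative (Fin k → ℤ) →* zkByPermZ k σ :=
  SemidirectProduct.inl

/-- The element `(v, 1)` of `ℤ^k ⋊_σ ℤ`, a lift of the generator of `ℤ`. -/
def liftGen (σ : Equiv.Perm (Fin k)) (v : Fin k → ℤ) : zkByPermZ k σ :=
  ⟨Multiplicative.ofAdd v, Multiplicative.ofAdd 1⟩

theorem emb_range : (emb σ).range = (SemidirectProduct.rightHom : zkByPermZ k σ →* _).ker :=
  SemidirectProduct.range_inl_eq_ker_rightHom

instance : (emb σ).range.Normal := by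
  rw [emb_range]; infer_instance

theorem liftGen_mul_emb (v w : Fin k → ℤ) :
    liftGen σ v * emb σ (.ofAdd w) * (liftGen σ v)⁻¹ = emb σ (.ofAdd (permAddEquiv σ w)) := by
  rw [mul_inv_eq_iff_eq_mul]
  ext1
  · simp only [SemidirectProduct.mul_left, emb, liftGen, SemidirectProduct.left_inl,
      SemidirectProduct.right_inl, map_one, MulAut.one_apply]
    rw [mul_comm, zpowersHom_apply, toAdd_ofAdd, zpow_one]
    rfl
  · simp [emb, liftGen]

theorem liftGen_add (v w : Fin k → ℤ) :
    liftGen σ (v + w) = emb σ (.ofAdd v) * liftGen σ w := by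
  ext1 <;> simp [emb, liftGen]

/-- Every element is a product of an element of `ℤ^k` and a power of a lift of the generator. -/
theorem mul_liftGen_zpow_mem_range (v : Fin k → ℤ) (x : zkByPermZ k σ) :
    x * liftGen σ v ^ (-(Multiplicative.toAdd x.right)) ∈ (emb σ).range := by
  rw [emb_range, MonoidHom.mem_ker, map_mul, map_zpow]
  change x.right * (Multiplicative.ofAdd (1 : ℤ)) ^ _ = 1
  rw [← ofAdd_zsmul]
  simp

theorem le_of_comap_le {H K : Subgroup (zkByPermZ k σ)} {v : Fin k → ℤ}
    (hH : liftGen σ v ∈ H) (hK : liftGen σ v ∈ K) (h : H.comap (emb σ) ≤ K.comap (emb σ)) :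
    H ≤ K := by
  intro x hx
  obtain ⟨w, hw⟩ := mul_liftGen_zpow_mem_range v x
  have : w ∈ H.comap (emb σ) := by
    rw [Subgroup.mem_comap, hw]
    exact H.mul_mem hx (H.zpow_mem hH _)
  have := K.mul_mem (h this) (K.zpow_mem hK (Multiplicative.toAdd x.right))
  rw [hw] at this
  simpa using this

theorem sup_range_eq_top {H : Subgroup (zkByPermZ k σ)} (hH : IsCoatom H)
    (h : ¬ (emb σ).range ≤ H) : H ⊔ (emb σ).range = ⊤ :=
  hH.2 _ (left_lt_sup.2 h)

theorem exists_liftGen_mem {H : Subgroup (zkByPermZ k σ)} (hH : H ⊔ (emb σ).range = ⊤) :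
    ∃ v, liftGen σ v ∈ H := by
  have : liftGen σ 0 ∈ H ⊔ (emb σ).range := hH ▸ Subgroup.mem_top _
  obtain ⟨y, hy, z, ⟨w, rfl⟩, hyz⟩ := Subgroup.mem_sup_of_normal_right.1 this
  refine ⟨Multiplicative.toAdd y.left, ?_⟩
  convert hy
  have := congrArg SemidirectProduct.right hyz
  ext1
  · rfl
  · simpa [emb, liftGen] using this.symm

theorem emb_map_normal {M : AddSubgroup (Fin k → ℤ)} (hM : ∀ v ∈ M, permAddEquiv σ v ∈ M) :
    ((AddSubgroup.toSubgroup M).map (emb σ)).Normal := by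
  have hit : ∀ n : ℕ, ∀ v ∈ M, (permAddEquiv σ)^[n] v ∈ M := by
    intro n
    induction n with
    | zero => exact fun v hv => hv
    | succ n ih => exact fun v hv => ih _ (hM v hv)
  have hsymm : ∀ v ∈ M, (permAddEquiv σ).symm v ∈ M := by
    intro v hv
    convert hit (orderOf σ - 1) v hv
    rw [AddEquiv.symm_apply_eq, ← Function.iterate_succ_apply' (permAddEquiv σ),
      Nat.succ_eq_add_one, Nat.sub_add_cancel (orderOf_pos σ), permAddEquiv_iterate_orderOf]
  set P := (AddSubgroup.toSubgroup M).map (emb σ)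
  have h1 : ∀ x ∈ P, liftGen σ 0 * x * (liftGen σ 0)⁻¹ ∈ P := by
    rintro _ ⟨w, hw, rfl⟩
    exact ⟨_, hM _ hw, (liftGen_mul_emb 0 w.toAdd).symm⟩
  have h2 : ∀ x ∈ P, (liftGen σ 0)⁻¹ * x * (liftGen σ 0) ∈ P := by
    rintro _ ⟨w, hw, rfl⟩
    refine ⟨_, hsymm _ hw, ?_⟩
    have := liftGen_mul_emb (σ := σ) 0 ((permAddEquiv σ).symm w.toAdd)
    rw [AddEquiv.apply_symm_apply] at this
    erw [← this]
    simp [mul_assoc]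
    rfl
  have h3 : liftGen σ 0 ∈ Subgroup.normalizer (P : Set (zkByPermZ k σ)) := by
    rw [Subgroup.mem_normalizer_iff]
    refine fun x => ⟨h1 x, fun hx => ?_⟩
    simpa [mul_assoc] using h2 _ hx
  have h4 : (emb σ).range ≤ Subgroup.normalizer (P : Set (zkByPermZ k σ)) := by
    rintro _ ⟨v, rfl⟩
    rw [Subgroup.mem_normalizer_iff]
    have key : ∀ v, ∀ x ∈ P, emb σ v * x * (emb σ v)⁻¹ ∈ P := by
      rintro v _ ⟨w, hw, rfl⟩
      rw [← map_mul, mul_comm v, map_mul, mul_inv_cancel_right]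
      exact ⟨w, hw, rfl⟩
    refine fun x => ⟨key v x, fun hx => ?_⟩
    simpa [mul_assoc] using key v⁻¹ _ hx
  rw [← Subgroup.normalizer_eq_top_iff, eq_top_iff]
  refine le_of_comap_le (v := 0) (Subgroup.mem_top _) h3 fun v _ => h4 ⟨v, rfl⟩

/-- A hom `f : ℤ^k → F` which is an eigenvector of the permutation action with eigenvalue `l`,
and whose kernel is the intersection of `H` with `ℤ^k`. -/
structure EigenHom (H : Subgroup (zkByPermZ k σ)) {F : Type*} [Field F]
    (f : (Fin k → ℤ) →+ F) (l : F) : Prop where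
  ne_zero : f ≠ 0
  map_perm : ∀ v, f (permAddEquiv σ v) = l * f v
  eq_zero_iff : ∀ v, f v = 0 ↔ emb σ (.ofAdd v) ∈ H

theorem exists_eigenHom {H : Subgroup (zkByPermZ k σ)} (hH : IsCoatom H)
    (h : ¬ (emb σ).range ≤ H) :
    ∃ (F : Type) (_ : Field F) (f : (Fin k → ℤ) →+ F) (l : F),
      Nat.card F = H.index ∧ EigenHom H f l := by
  have htop := sup_range_eq_top hH h
  obtain ⟨v₀, hv₀⟩ := exists_liftGen_mem htop
  let T : Module.End ℤ (Fin k → ℤ) := (permAddEquiv σ).toAddMonoidHom.toIntLinearMap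
  let A := Module.AEval ℤ (Fin k → ℤ) T
  let of : (Fin k → ℤ) ≃ₗ[ℤ] A := Module.AEval.of ℤ (Fin k → ℤ) T
  have hX : ∀ v, of (permAddEquiv σ v) = (Polynomial.X : Polynomial ℤ) • of v := fun v =>
    (Module.AEval.X_smul_of (R := ℤ) T v).symm
  let M : Submodule (Polynomial ℤ) A :=
    { carrier := {a | emb σ (.ofAdd (of.symm a)) ∈ H}
      add_mem' := by
        intro a b ha hb
        simp only [Set.mem_ofPred_eq, map_add, ofAdd_add, map_mul] at *
        exact H.mul_mem ha hb
      zero_mem' := by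
        simp only [Set.mem_ofPred_eq, map_zero, ofAdd_zero, map_one]
        exact H.one_mem
      smul_mem' := by
        intro p a ha
        induction p using Polynomial.induction_on' generalizing a with
        | add p q hp hq =>
          have h1 := hp ha
          have h2 := hq ha
          simp only [Set.mem_ofPred_eq, add_smul, map_add, ofAdd_add, map_mul] at *
          exact H.mul_mem h1 h2
        | monomial n z =>
          induction n generalizing a with
          | zero =>
            rw [Polynomial.monomial_zero_left, Module.AEval.C_smul]
            change emb σ (.ofAdd (of.symm (z • a))) ∈ H
            rw [of.symm.map_smul z a, ofAdd_zsmul, map_zpow]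
            exact H.zpow_mem ha _
          | succ n ih =>
            rw [← Polynomial.monomial_mul_X, mul_smul]
            refine ih ?_
            obtain ⟨v, rfl⟩ := of.surjective a
            rw [← hX]
            simp only [Set.mem_ofPred_eq, LinearEquiv.symm_apply_apply] at *
            rw [← liftGen_mul_emb v₀]
            exact H.mul_mem (H.mul_mem hv₀ ha) (H.inv_mem hv₀) }
  have hmem : ∀ v, of v ∈ M ↔ emb σ (.ofAdd v) ∈ H := by
    intro v
    change emb σ (.ofAdd (of.symm (of v))) ∈ H ↔ _
    rw [LinearEquiv.symm_apply_apply]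
  have hM : IsCoatom M := by
    refine ⟨fun hMt => h ?_, fun M' hM' => ?_⟩
    · rintro _ ⟨v, rfl⟩
      exact (hmem v.toAdd).1 (hMt ▸ Submodule.mem_top)
    · let M₁ : AddSubgroup (Fin k → ℤ) := M'.toAddSubgroup.comap of.toLinearMap.toAddMonoidHom
      have hM₁ : ∀ v, v ∈ M₁ ↔ of v ∈ M' := fun v => Iff.rfl
      have hinv : ∀ v ∈ M₁, permAddEquiv σ v ∈ M₁ := by
        intro v hv
        rw [hM₁, hX]
        exact M'.smul_mem _ hv
      have := emb_map_normal hinv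
      obtain ⟨a, ha', ha⟩ := SetLike.exists_of_lt hM'
      obtain ⟨v, rfl⟩ := of.surjective a
      have hlt : H < H ⊔ (AddSubgroup.toSubgroup M₁).map (emb σ) := by
        refine left_lt_sup.2 fun hle => ha ((hmem v).2 (hle ⟨.ofAdd v, ha', rfl⟩))
      have hsup := hH.2 _ hlt
      rw [eq_top_iff]
      rintro b -
      obtain ⟨w, rfl⟩ := of.surjective b
      have hw : emb σ (.ofAdd w) ∈ H ⊔ (AddSubgroup.toSubgroup M₁).map (emb σ) :=
        hsup ▸ Subgroup.mem_top _
      obtain ⟨y, hy, _, ⟨u, hu, rfl⟩, hyu⟩ := Subgroup.mem_sup_of_normal_right.1 hw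
      have hy' : y = emb σ (.ofAdd (w - u.toAdd)) := by
        rw [ofAdd_sub, map_div, eq_div_iff_mul_eq']
        exact hyu
      rw [hy', ← hmem] at hy
      have := M₁.add_mem (x := w - u.toAdd) (hM'.le hy) hu
      change w - u.toAdd + u.toAdd ∈ M₁ at this
      rwa [sub_add_cancel] at this
  have hsimple := isSimpleModule_iff_isCoatom.2 hM
  obtain ⟨I, hI, ⟨e⟩⟩ := isSimpleModule_iff_quot_maximal.1 hsimple
  let _ := Ideal.Quotient.field I
  let f : (Fin k → ℤ) →+ Polynomial ℤ ⧸ I :=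
    (e.toLinearMap.toAddMonoidHom.comp M.mkQ.toAddMonoidHom).comp of.toLinearMap.toAddMonoidHom
  have hf : ∀ v, f v = e (M.mkQ (of v)) := fun v => rfl
  have hsurj : Function.Surjective f :=
    e.surjective.comp (M.mkQ_surjective.comp of.surjective)
  have hker : ∀ v, f v = 0 ↔ emb σ (.ofAdd v) ∈ H := by
    intro v
    rw [hf, map_eq_zero_iff e e.injective, Submodule.mkQ_apply, Submodule.Quotient.mk_eq_zero, hmem]
  refine ⟨Polynomial ℤ ⧸ I, inferInstance, f, Ideal.Quotient.mk I Polynomial.X, ?_, ?_, ?_, hker⟩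
  · let g : (Fin k → ℤ) → zkByPermZ k σ ⧸ H := fun v => (emb σ (.ofAdd v) : zkByPermZ k σ)
    have hg : Function.Surjective g := by
      intro q
      obtain ⟨x, rfl⟩ := QuotientGroup.mk_surjective q
      have hx : x ∈ (emb σ).range ⊔ H := by
        rw [sup_comm, htop]
        exact Subgroup.mem_top _
      obtain ⟨_, ⟨v, rfl⟩, y, hy, rfl⟩ := Subgroup.mem_sup_of_normal_left.1 hx
      exact ⟨v.toAdd, (QuotientGroup.mk_mul_of_mem _ hy).symm⟩
    have hfg : Setoid.ker f = Setoid.ker g := by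
      ext v w
      rw [Setoid.ker_def, Setoid.ker_def, eq_comm, ← sub_eq_zero, ← map_sub, hker]
      simp only [g]
      rw [QuotientGroup.eq, ← map_inv, ← map_mul, ← ofAdd_neg, ← ofAdd_add, neg_add_eq_sub]
    rw [Subgroup.index, ← Nat.card_congr (Setoid.quotientKerEquivOfSurjective f hsurj),
      ← Nat.card_congr (Setoid.quotientKerEquivOfSurjective g hg), hfg]
  · rintro h0
    obtain ⟨v, hv⟩ := hsurj 1
    rw [h0] at hv
    exact zero_ne_one hv
  · intro v
    rw [hf, hX, map_smul, map_smul, hf]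
    rfl

theorem eigen_single {F : Type*} [Field F] {f : (Fin k → ℤ) →+ F} {l : F}
    (hf : ∀ v, f (permAddEquiv σ v) = l * f v) (i : Fin k) (n : ℕ) :
    f (Pi.single ((σ ^ n) i) 1) = l ^ n * f (Pi.single i 1) := by
  induction n with
  | zero => simp
  | succ n ih =>
    rw [pow_succ', Equiv.Perm.mul_apply, ← permAddEquiv_single, hf, ih, pow_succ', mul_assoc]

/-- The set of cycles of `σ`. -/
abbrev Cycles (σ : Equiv.Perm (Fin k)) : Type :=
  Quotient (MulAction.orbitRel (Subgroup.zpowers σ) (Fin k))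

/-- An eigenvector of the permutation action with given eigenvalue is determined by its values
at representatives of the cycles. -/
theorem eigen_ext {F : Type*} [Field F] {f g : (Fin k → ℤ) →+ F} {l : F}
    (hf : ∀ v, f (permAddEquiv σ v) = l * f v) (hg : ∀ v, g (permAddEquiv σ v) = l * g v)
    (h : ∀ q : Cycles σ, f (Pi.single q.out 1) = g (Pi.single q.out 1)) : f = g := by
  refine AddMonoidHom.functions_ext' _ _ _ (fun i => AddMonoidHom.ext_int ?_)
  have hi : i ∈ MulAction.orbit (Subgroup.zpowers σ) (⟦i⟧ : Cycles σ).out :=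
    (MulAction.orbitRel (Subgroup.zpowers σ) (Fin k)).symm (Quotient.mk_out i)
  obtain ⟨⟨τ, hτ⟩, hi⟩ := hi
  obtain ⟨n, rfl⟩ := mem_powers_iff_mem_zpowers.2 hτ
  change (σ ^ n) (⟦i⟧ : Cycles σ).out = i at hi
  simp only [AddMonoidHom.comp_apply, AddMonoidHom.single_apply]
  rw [← hi, eigen_single hf, eigen_single hg, h]

namespace EigenHom

variable {H : Subgroup (zkByPermZ k σ)} {F F' : Type*} [Field F] [Field F']
  {f : (Fin k → ℤ) →+ F} {l : F}

theorem pow_orderOf (h : EigenHom H f l) : l ^ orderOf σ = 1 := by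
  obtain ⟨v, hv⟩ := DFunLike.ne_iff.1 h.ne_zero
  have key : ∀ n, f ((permAddEquiv σ)^[n] v) = l ^ n * f v := by
    intro n
    induction n with
    | zero => simp
    | succ n ih => rw [Function.iterate_succ_apply', h.map_perm, ih, pow_succ', mul_assoc]
  have := key (orderOf σ)
  rw [permAddEquiv_iterate_orderOf] at this
  exact mul_right_cancel₀ hv (by rw [← this, one_mul])

theorem map (h : EigenHom H f l) (e : F ≃+* F') :
    EigenHom H (e.toAddMonoidHom.comp f) (e l) where
  ne_zero h0 := h.ne_zero <| by
    refine AddMonoidHom.ext fun v => ?_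
    simpa using DFunLike.congr_fun h0 v
  map_perm v := by simp [h.map_perm]
  eq_zero_iff v := by simp [h.eq_zero_iff]

end EigenHom

/-- The maximal subgroups of index `n` that do not contain `ℤ^k`. -/
def complSubgroups (σ : Equiv.Perm (Fin k)) (n : ℕ) : Set (Subgroup (zkByPermZ k σ)) :=
  {H | (IsCoatom H ∧ H.index = n) ∧ ¬ (emb σ).range ≤ H}

theorem card_nthRootsFinset_le {F : Type*} [Field F] (n : ℕ) :
    (Polynomial.nthRootsFinset n (1 : F)).card ≤ n := by
  classical
  rw [Polynomial.nthRootsFinset_def]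
  exact (Multiset.toFinset_card_le _).trans (Polynomial.card_nthRoots n 1)

theorem complSubgroups_bound (σ : Equiv.Perm (Fin k)) {n : ℕ} (hn : 2 ≤ n) :
    (complSubgroups σ n).Finite ∧
      (complSubgroups σ n).ncard * (n - 1) ≤ orderOf σ * n ^ Nat.card (Cycles σ) * n := by
  obtain h0 | ⟨H₀, ⟨hm₀, hi₀⟩, hr₀⟩ := (complSubgroups σ n).eq_empty_or_nonempty
  · simp [h0]
  obtain ⟨F, _, f₀, l₀, hF, -⟩ := exists_eigenHom hm₀ hr₀
  rw [hi₀] at hF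
  have : Finite F := Nat.finite_of_card_ne_zero (by omega)
  have hex : ∀ H : complSubgroups σ n, ∃ (f : (Fin k → ℤ) →+ F) (l : F) (v : Fin k → ℤ),
      EigenHom H.1 f l ∧ liftGen σ v ∈ H.1 := by
    rintro ⟨H, ⟨hm, hi⟩, hr⟩
    obtain ⟨F', _, f, l, hF', hf⟩ := exists_eigenHom hm hr
    obtain ⟨v, hv⟩ := exists_liftGen_mem (sup_range_eq_top hm hr)
    have : Finite F' := Nat.finite_of_card_ne_zero (by omega)
    have := Fintype.ofFinite F
    have := Fintype.ofFinite F'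
    have e : F' ≃+* F := FiniteField.ringEquivOfCardEq (by
      rw [← Nat.card_eq_fintype_card, ← Nat.card_eq_fintype_card, hF', hF, hi])
    exact ⟨_, _, v, hf.map e, hv⟩
  choose f l v hf hv using hex
  let Φ : complSubgroups σ n × Fˣ →
      (Polynomial.nthRootsFinset (orderOf σ) (1 : F) × (Cycles σ → F)) × F := fun x =>
    ((⟨l x.1, (Polynomial.mem_nthRootsFinset (orderOf_pos σ) 1).2 (hf x.1).pow_orderOf⟩,
      fun q => x.2 * f x.1 (Pi.single q.out 1)), x.2 * f x.1 (v x.1))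
  have hΦ : Function.Injective Φ := by
    rintro ⟨H, a⟩ ⟨K, b⟩ hHK
    simp only [Φ, Prod.mk.injEq, Subtype.mk.injEq] at hHK
    obtain ⟨⟨hl, hq⟩, hc⟩ := hHK
    have hfg : (AddMonoidHom.mulLeft (a : F)).comp (f H) =
        (AddMonoidHom.mulLeft (b : F)).comp (f K) := by
      refine eigen_ext (σ := σ) (l := l H) (fun v => ?_) (fun v => ?_) fun q => congrFun hq q
      · simp [(hf H).map_perm, mul_left_comm]
      · simp [(hf K).map_perm, mul_left_comm, hl]
    have hfg' : ∀ w, a * f H w = b * f K w := fun w => DFunLike.congr_fun hfg w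
    have hcomap : H.1.comap (emb σ) = K.1.comap (emb σ) := by
      ext w
      have h1 := (hf H).eq_zero_iff w.toAdd
      have h2 := (hf K).eq_zero_iff w.toAdd
      rw [ofAdd_toAdd] at h1 h2
      rw [Subgroup.mem_comap, Subgroup.mem_comap, ← h1, ← h2, ← Units.mul_right_eq_zero a, hfg',
        Units.mul_right_eq_zero]
    have hvK : liftGen σ (v H) ∈ K.1 := by
      rw [← sub_add_cancel (v H) (v K), liftGen_add]
      refine K.1.mul_mem (((hf K).eq_zero_iff _).1 ?_) (hv K)
      rw [← Units.mul_right_eq_zero b, map_sub, mul_sub, ← hfg', hc, sub_self]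
    have hHK : H = K := Subtype.ext
      (le_antisymm (le_of_comap_le (hv H) hvK hcomap.le) (le_of_comap_le hvK (hv H) hcomap.ge))
    subst hHK
    obtain ⟨w, hw⟩ := DFunLike.ne_iff.1 (hf H).ne_zero
    have hab : a = b := Units.ext (mul_right_cancel₀ hw (hfg' w))
    rw [hab]
  have hfin : Finite (complSubgroups σ n × Fˣ) := Finite.of_injective Φ hΦ
  have : Finite (complSubgroups σ n) := Finite.prod_left Fˣ
  refine ⟨this, ?_⟩
  have hle := Nat.card_le_card_of_injective Φ hΦ
  rw [Nat.card_prod, Nat.card_prod, Nat.card_prod, Nat.card_units, Nat.card_fun, hF,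
    Nat.card_coe_set_eq, Nat.card_eq_fintype_card, Fintype.card_coe] at hle
  exact hle.trans (by gcongr; exact card_nthRootsFinset_le _)

theorem subgroup_int_eq_of_index {K : Subgroup (Multiplicative ℤ)} {n : ℕ} (h : K.index = n) :
    K = Subgroup.zpowers (Multiplicative.ofAdd (n : ℤ)) := by
  obtain ⟨a, rfl⟩ := Subgroup.isCyclic_iff_exists_zpowers_eq_top K |>.1 inferInstance
  have h1 : (AddSubgroup.zmultiples (Multiplicative.toAdd a)).index = n := h
  rw [Int.index_zmultiples] at h1
  have h2 : AddSubgroup.zmultiples (Multiplicative.toAdd a) = AddSubgroup.zmultiples (n : ℤ) := by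
    rw [← h1, Int.zmultiples_natAbs]
  ext x
  exact SetLike.ext_iff.1 h2 x.toAdd

theorem maximal_ge_subsingleton (n : ℕ) :
    {H : Subgroup (zkByPermZ k σ) |
      (IsCoatom H ∧ H.index = n) ∧ (emb σ).range ≤ H}.Subsingleton := by
  let π : zkByPermZ k σ →* Multiplicative ℤ := SemidirectProduct.rightHom
  have key : ∀ H : Subgroup (zkByPermZ k σ), H.index = n → (emb σ).range ≤ H →
      H = (Subgroup.zpowers (Multiplicative.ofAdd (n : ℤ))).comap π := by
    intro H hn hr
    rw [emb_range] at hr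
    rw [← subgroup_int_eq_of_index (K := H.map π), Subgroup.comap_map_eq_self hr]
    rw [Subgroup.index_map_eq _ SemidirectProduct.rightHom_surjective hr, hn]
  rintro H ⟨⟨-, hn⟩, hr⟩ K ⟨⟨-, hn'⟩, hr'⟩
  rw [key H hn hr, key K hn' hr']

theorem maximal_eq_union (n : ℕ) :
    {H : Subgroup (zkByPermZ k σ) | IsCoatom H ∧ H.index = n} =
      {H | (IsCoatom H ∧ H.index = n) ∧ (emb σ).range ≤ H} ∪ complSubgroups σ n := by
  ext H
  simp only [complSubgroups, Set.mem_union, Set.mem_ofPred_eq]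
  tauto

theorem maximal_finite (σ : Equiv.Perm (Fin k)) {n : ℕ} (hn : 2 ≤ n) :
    {H : Subgroup (zkByPermZ k σ) | IsCoatom H ∧ H.index = n}.Finite := by
  rw [maximal_eq_union]
  exact (maximal_ge_subsingleton n).finite.union (complSubgroups_bound σ hn).1

theorem maxSubgroupCount_le (σ : Equiv.Perm (Fin k)) {n : ℕ} (hn : 2 ≤ n) :
    maxSubgroupCount (zkByPermZ k σ) n ≤ (2 * orderOf σ + 1) * n ^ Nat.card (Cycles σ) := by
  have h1 : maxSubgroupCount (zkByPermZ k σ) n ≤ 1 + (complSubgroups σ n).ncard := by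
    change Nat.card {H : Subgroup (zkByPermZ k σ) | IsCoatom H ∧ H.index = n} ≤ _
    rw [Nat.card_coe_set_eq, maximal_eq_union]
    refine (Set.ncard_union_le _ _).trans ?_
    gcongr
    exact (Set.ncard_le_one (maximal_ge_subsingleton n).finite).2 fun _ ha _ hb =>
      maximal_ge_subsingleton n ha hb
  have h2 := (complSubgroups_bound σ hn).2
  obtain ⟨m, rfl⟩ : ∃ m, n = m + 1 := ⟨n - 1, by omega⟩
  have h3 : (complSubgroups σ (m + 1)).ncard ≤
      2 * (orderOf σ * (m + 1) ^ Nat.card (Cycles σ)) := by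
    refine Nat.le_of_mul_le_mul_right (c := m) ?_ (by omega)
    refine h2.trans ?_
    rw [mul_comm 2, mul_assoc _ 2 m]
    exact Nat.mul_le_mul_left _ (by omega)
  have h4 : 1 ≤ (m + 1) ^ Nat.card (Cycles σ) := Nat.one_le_pow _ _ (by omega)
  calc _ ≤ _ := h1
    _ ≤ (m + 1) ^ Nat.card (Cycles σ) + 2 * (orderOf σ * (m + 1) ^ Nat.card (Cycles σ)) := by
      gcongr
    _ = _ := by ring

theorem isCoatom_of_index_prime {G : Type*} [Group G] {H : Subgroup G} (h : H.index.Prime) :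
    IsCoatom H := by
  refine ⟨fun ht => h.ne_one (by rw [ht, Subgroup.index_top]), fun K hK => ?_⟩
  have hmul := Subgroup.relIndex_mul_index hK.le
  rcases (Nat.dvd_prime h).1 (Dvd.intro_left _ hmul) with h1 | h1
  · exact Subgroup.index_eq_one.1 h1
  · rw [h1] at hmul
    have : H.relIndex K = 1 := Nat.eq_of_mul_eq_mul_right h.pos (by rw [hmul, one_mul])
    exact absurd (Subgroup.relIndex_eq_one.1 this) (not_le_of_gt hK)

/-- The hom `ℤ^k → ℤ/p` with value `w q` at the basis vectors in the cycle `q`. -/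
def cycleHom {p : ℕ} (w : Cycles σ → ZMod p) : (Fin k → ℤ) →+ ZMod p where
  toFun v := ∑ i, (v i : ZMod p) * w ⟦i⟧
  map_zero' := by simp
  map_add' v v' := by simp [add_mul, Finset.sum_add_distrib]

theorem cycleHom_single {p : ℕ} (w : Cycles σ → ZMod p) (i : Fin k) :
    cycleHom w (Pi.single i 1) = w ⟦i⟧ := by
  change ∑ j, ((Pi.single i 1 : Fin k → ℤ) j : ZMod p) * w ⟦j⟧ = _
  rw [Finset.sum_eq_single i] <;> simp +contextual

theorem cycleHom_perm {p : ℕ} (w : Cycles σ → ZMod p) (v : Fin k → ℤ) :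
    cycleHom w (permAddEquiv σ v) = cycleHom w v := by
  change ∑ j, (permAddEquiv σ v j : ZMod p) * w ⟦j⟧ = ∑ j, (v j : ZMod p) * w ⟦j⟧
  rw [← Equiv.sum_comp σ]
  refine Finset.sum_congr rfl fun i _ => ?_
  rw [permAddEquiv_apply, Equiv.symm_apply_apply]
  congr 2
  exact Quotient.sound ⟨⟨σ, Subgroup.mem_zpowers σ⟩, rfl⟩

theorem cycleHom_zpow {p : ℕ} (w : Cycles σ → ZMod p) (z : ℤ) (v : Multiplicative (Fin k → ℤ)) :
    AddMonoidHom.toMultiplicative (cycleHom w)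
        ((AddEquiv.toMultiplicative (permAddEquiv σ) : MulAut _) ^ z • v) =
      AddMonoidHom.toMultiplicative (cycleHom w) v := by
  set α : MulAut (Multiplicative (Fin k → ℤ)) := AddEquiv.toMultiplicative (permAddEquiv σ)
  have hα : ∀ v, AddMonoidHom.toMultiplicative (cycleHom w) (α • v) =
      AddMonoidHom.toMultiplicative (cycleHom w) v := fun v => cycleHom_perm w v.toAdd
  induction z generalizing v with
  | zero => simp
  | succ n ih => rw [zpow_add_one, mul_smul, ih, hα]
  | pred n ih => rw [zpow_sub_one, mul_smul, ih, ← hα, smul_inv_smul]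

/-- The hom `ℤ^k ⋊_σ ℤ → ℤ/p` extending `cycleHom w` and sending the generator to `1`. -/
def cycleLift {p : ℕ} (w : Cycles σ → ZMod p) : zkByPermZ k σ →* Multiplicative (ZMod p) :=
  SemidirectProduct.lift (AddMonoidHom.toMultiplicative (cycleHom w))
    (AddMonoidHom.toMultiplicative (Int.castAddHom (ZMod p))) <| by
      intro g
      refine MonoidHom.ext fun v => ?_
      simpa using cycleHom_zpow w g.toAdd v

theorem cycleLift_mk {p : ℕ} (w : Cycles σ → ZMod p) (v : Fin k → ℤ) (z : ℤ) :
    cycleLift w ⟨.ofAdd v, .ofAdd z⟩ = Multiplicative.ofAdd (cycleHom w v + z) := rfl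

theorem cycleLift_ker_index {p : ℕ} (w : Cycles σ → ZMod p) : (cycleLift w).ker.index = p := by
  rw [Subgroup.index_ker, MonoidHom.range_eq_top.2, Subgroup.card_top]
  · exact Nat.card_zmod p
  · intro a
    obtain ⟨z, hz⟩ := ZMod.intCast_surjective (Multiplicative.toAdd a)
    refine ⟨⟨.ofAdd 0, .ofAdd z⟩, ?_⟩
    rw [cycleLift_mk, map_zero, zero_add, hz, ofAdd_toAdd]

theorem cycleLift_ker_injective (p : ℕ) :
    Function.Injective fun w : Cycles σ → ZMod p => (cycleLift w).ker := by
  intro w w' h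
  ext1 q
  obtain ⟨z, hz⟩ := ZMod.intCast_surjective (w q)
  have key : ∀ w : Cycles σ → ZMod p, cycleHom w (Pi.single q.out 1) = w q := fun w => by
    rw [cycleHom_single, Quotient.out_eq]
  have hmem : (⟨.ofAdd (Pi.single q.out 1), .ofAdd (-z)⟩ : zkByPermZ k σ) ∈ (cycleLift w).ker := by
    rw [MonoidHom.mem_ker, cycleLift_mk, key, Int.cast_neg, hz, add_neg_cancel, ofAdd_zero]
  simp only at h
  rw [h, MonoidHom.mem_ker, cycleLift_mk, key, Int.cast_neg, hz, ofAdd_eq_one,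
    add_neg_eq_zero] at hmem
  exact hmem.symm

theorem le_maxSubgroupCount (σ : Equiv.Perm (Fin k)) {p : ℕ} (hp : p.Prime) :
    p ^ Nat.card (Cycles σ) ≤ maxSubgroupCount (zkByPermZ k σ) p := by
  have : Fact p.Prime := ⟨hp⟩
  have : Finite {H : Subgroup (zkByPermZ k σ) // IsCoatom H ∧ H.index = p} :=
    maximal_finite σ hp.two_le
  let Ψ : (Cycles σ → ZMod p) → {H : Subgroup (zkByPermZ k σ) // IsCoatom H ∧ H.index = p} :=
    fun w => ⟨(cycleLift w).ker,
      isCoatom_of_index_prime (by rw [cycleLift_ker_index]; exact hp), cycleLift_ker_index w⟩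
  have hΨ : Function.Injective Ψ := fun w w' h =>
    cycleLift_ker_injective p (congrArg Subtype.val h)
  have := Nat.card_le_card_of_injective Ψ hΨ
  rwa [Nat.card_fun, Nat.card_zmod] at this

end zkByPermZ

/-- A group whose maximal subgroup counts are at most `C * n ^ c`, and at least `n ^ c` for
prime `n`, has degree of maximal subgroup growth `c`. -/
theorem mdeg_eq_of_bounds {G : Type*} [Group G] {C c : ℕ}
    (hle : ∀ n, 2 ≤ n → maxSubgroupCount G n ≤ C * n ^ c)
    (hge : ∀ p, p.Prime → p ^ c ≤ maxSubgroupCount G p) : mdeg G = c := by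
  have hC : 0 < C := Nat.pos_of_mul_pos_right
    ((pow_pos two_pos c).trans_le ((hge 2 Nat.prime_two).trans (hle 2 le_rfl)))
  have hlog : Filter.Tendsto (fun n : ℕ => Real.log n) Filter.atTop Filter.atTop :=
    Real.tendsto_log_atTop.comp tendsto_natCast_atTop_atTop
  have hlim : Filter.Tendsto (fun n : ℕ => Real.log C / Real.log n + c) Filter.atTop
      (nhds (c : ℝ)) := by
    simpa using (hlog.const_div_atTop (Real.log C)).add_const (c : ℝ)
  have hupper : ∀ᶠ n : ℕ in Filter.atTop,
      Real.log (maxSubgroupCount G n) / Real.log n ≤ Real.log C / Real.log n + c := by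
    filter_upwards [Filter.eventually_ge_atTop 2] with n hn
    have hn' : 0 < Real.log n := Real.log_pos (by exact_mod_cast hn)
    have hn0 : (0 : ℝ) < n := by positivity
    rw [div_add' _ _ _ hn'.ne', ← Real.log_pow, ← Real.log_mul (by positivity) (by positivity)]
    gcongr ?_ / _
    obtain h0 | h0 := (maxSubgroupCount G n).eq_zero_or_pos
    · rw [h0, Nat.cast_zero, Real.log_zero]
      exact Real.log_nonneg (by exact_mod_cast Nat.mul_pos hC (by positivity))
    · exact Real.log_le_log (by exact_mod_cast h0) (by exact_mod_cast hle n hn)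
  have hbdd := hlim.isBoundedUnder_le.mono_le hupper
  have hnonneg : ∀ n : ℕ, 0 ≤ Real.log (maxSubgroupCount G n) / Real.log n := fun n =>
    div_nonneg (Real.log_natCast_nonneg _) (Real.log_natCast_nonneg _)
  have hcobdd : Filter.atTop.IsCoboundedUnder (· ≤ ·)
      fun n : ℕ => Real.log (maxSubgroupCount G n) / Real.log n :=
    (Filter.isBoundedUnder_of ⟨0, hnonneg⟩ : Filter.IsBoundedUnder (· ≥ ·) _ _).isCoboundedUnder_le
  refine le_antisymm ?_ ?_
  · rw [← hlim.limsup_eq]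
    exact Filter.limsup_le_limsup hupper hcobdd hlim.isBoundedUnder_le
  · refine Filter.le_limsup_of_frequently_le ?_ hbdd
    refine Filter.frequently_atTop.2 fun a => ?_
    obtain ⟨p, hap, hp⟩ := Nat.exists_infinite_primes a
    refine ⟨p, hap, ?_⟩
    have hp' : 0 < Real.log p := Real.log_pos (by exact_mod_cast hp.one_lt)
    have hp0 : (0 : ℝ) < p := by exact_mod_cast hp.pos
    rw [le_div_iff₀ hp', ← Real.log_pow]
    exact Real.log_le_log (by positivity) (by exact_mod_cast hge p hp)

theorem stmt19 {k : ℕ} (σ : Equiv.Perm (Fin k)) (c : ℕ)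
    -- `σ` has exactly `c` cycles (fixed points counted as cycles), i.e. the cyclic
    -- group generated by `σ` has exactly `c` orbits on `{1, …, k}`
    (hc : c = Nat.card (Quotient (MulAction.orbitRel (Subgroup.zpowers σ) (Fin k)))) :
    mdeg (zkByPermZ k σ) = c := by
  rw [hc]
  exact mdeg_eq_of_bounds (fun _ => zkByPermZ.maxSubgroupCount_le σ)
    fun _ => zkByPermZ.le_maxSubgroupCount σ
end
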